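/- Suppose in addition that there is a symbol i* ∈ U with L(i*) = 1 whose map attracts the whole space uniformly to its unique fixed point: sup_{y ∈ X} |f_{i*}^[m](y) − x_{i*}^0| → 0 as m → ∞. Then there exists m_min ≥ 1 such that for every input sequence v : ℤ → U with minimum repetitions ≥ m_min in which the symbol i* occurs at arbitrarily negative times, the set X_0(v) = ⋂_{n≥1} X_{−n,0}(v) is a singleton {x₀}, there is a unique entire solution x for input v (with x(0) = x₀), and it is globally pullback attracting: sup_{y ∈ X_{−n,0}(v)} |y − x₀| → 0 as n → ∞. (Hence the system has echo index one for such inputs.) -/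

import Mathlib

/-- The pullback composition `f_{v(k-1)} ∘ f_{v(k-2)} ∘ ⋯ ∘ f_{v(k-n)}` of the driven
system, over `n` steps ending at time `k`. -/
def pullComp {d M : ℕ}
    (f : Fin M → EuclideanSpace ℝ (Fin d) → EuclideanSpace ℝ (Fin d))
    (v : ℤ → Fin M) (k : ℤ) :
    ℕ → (EuclideanSpace ℝ (Fin d) → EuclideanSpace ℝ (Fin d))
  | 0 => id
  | (n + 1) => pullComp f v k n ∘ f (v (k - (n + 1)))

/-- The basin of attraction, within `X`, of the point `p` under the map `g`. -/
def basinOf {d : ℕ} (X : Set (EuclideanSpace ℝ (Fin d)))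
    (g : EuclideanSpace ℝ (Fin d) → EuclideanSpace ℝ (Fin d))
    (p : EuclideanSpace ℝ (Fin d)) : Set (EuclideanSpace ℝ (Fin d)) :=
  {y ∈ X | Filter.Tendsto (fun n : ℕ => g^[n] y) Filter.atTop (nhds p)}

/-- `v` has minimum repetitions `≥ m`: every maximal constant block of `v` has length at
least `m`. -/
def MinRepetitions {M : ℕ} (v : ℤ → Fin M) (m : ℕ) : Prop :=
  ∀ k : ℤ, v k ≠ v (k + 1) → ∀ j : ℕ, 1 ≤ j → j ≤ m → v (k + j) = v (k + 1)

/-- An entire solution for input `v`: a bi-infinite trajectory in `X` of the driven system. -/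
def IsEntireSolution {d M : ℕ} (X : Set (EuclideanSpace ℝ (Fin d)))
    (f : Fin M → EuclideanSpace ℝ (Fin d) → EuclideanSpace ℝ (Fin d))
    (v : ℤ → Fin M) (x : ℤ → EuclideanSpace ℝ (Fin d)) : Prop :=
  (∀ k : ℤ, x k ∈ X) ∧ ∀ k : ℤ, x (k + 1) = f (v k) (x k)

open Filter Topology Metric

section LocalContraction

variable {E : Type*} [NormedAddCommGroup E] [NormedSpace ℝ E]

theorem ContDiff.exists_lipschitzOnWith_iterate {g : E → E} (hg : ContDiff ℝ 1 g) (n : ℕ) (x : E) :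
    ∃ K, ∃ s ∈ 𝓝 x, LipschitzOnWith K g^[n] s := by
  have h : ContDiff ℝ 1 g^[n] := by
    induction n with
    | zero => exact contDiff_id
    | succ n ih => exact ih.comp hg
  exact (h.contDiffAt.hasStrictFDerivAt one_ne_zero).exists_lipschitzOnWith

/-- Near a hyperbolically stable fixed point the Lipschitz constants of the iterates tend to
zero. -/
theorem exists_ball_iterate_contracting {g : E → E} (hg : ContDiff ℝ 1 g) {p : E} (hp : g p = p)
    {N : ℕ} (hN : 1 ≤ N) (hlt : ‖(fderiv ℝ g p) ^ N‖ < 1) :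
    ∃ r > 0, ∀ ε > 0, ∀ᶠ n in atTop, ∀ y ∈ ball p r, ∀ z ∈ ball p r,
      dist (g^[n] y) (g^[n] z) ≤ ε * dist y z := by
  obtain ⟨c, hc, hc1⟩ : ∃ c : NNReal, ‖(fderiv ℝ g p) ^ N‖₊ < c ∧ c < 1 := exists_between hlt
  obtain ⟨s, hs, hsl⟩ := ((hg.contDiffAt.hasStrictFDerivAt one_ne_zero).iterate hp
    N).exists_lipschitzOnWith_of_nnnorm_lt c hc
  choose K t ht htl using fun n => hg.exists_lipschitzOnWith_iterate n p
  have hU : s ∩ ⋂ i ∈ Finset.range N, t i ∈ 𝓝 p :=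
    inter_mem hs ((biInter_finset_mem _).2 fun i _ => ht i)
  obtain ⟨r, hr, hrU⟩ := Metric.mem_nhds_iff.1 hU
  have hfix : g^[N] p = p := Function.iterate_fixed hp N
  have hpr : p ∈ ball p r := mem_ball_self hr
  have hmap : Set.MapsTo g^[N] (ball p r) (ball p r) := by
    intro y hy
    have h := hsl.dist_le_mul y (hrU hy).1 p (hrU hpr).1
    rw [hfix] at h
    have : (c : ℝ) * dist y p ≤ 1 * dist y p := by gcongr; exact_mod_cast hc1.le
    rw [mem_ball] at hy ⊢
    linarith
  have hpow : ∀ q : ℕ, ∀ y ∈ ball p r, ∀ z ∈ ball p r,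
      dist ((g^[N])^[q] y) ((g^[N])^[q] z) ≤ (c : ℝ) ^ q * dist y z := by
    intro q
    induction q with
    | zero => simp
    | succ q ih =>
      intro y hy z hz
      calc dist ((g^[N])^[q] (g^[N] y)) ((g^[N])^[q] (g^[N] z))
          ≤ (c : ℝ) ^ q * dist (g^[N] y) (g^[N] z) := ih _ (hmap hy) _ (hmap hz)
        _ ≤ (c : ℝ) ^ q * (c * dist y z) := by
            gcongr; exact hsl.dist_le_mul y (hrU hy).1 z (hrU hz).1
        _ = (c : ℝ) ^ (q + 1) * dist y z := by ring
  have htend : Tendsto (fun n : ℕ => ((∑ i ∈ Finset.range N, K i : NNReal) : ℝ) * (c : ℝ) ^ (n / N))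
      atTop (𝓝 0) := by
    have h1 : Tendsto (fun n : ℕ => (c : ℝ) ^ (n / N)) atTop (𝓝 0) :=
      (tendsto_pow_atTop_nhds_zero_of_lt_one c.2 (by exact_mod_cast hc1)).comp
        (Nat.tendsto_div_const_atTop (by omega))
    simpa using h1.const_mul ((∑ i ∈ Finset.range N, K i : NNReal) : ℝ)
  refine ⟨r, hr, fun ε hε => ?_⟩
  filter_upwards [htend.eventually_lt_const hε] with n hn y hy z hz
  have hmod : n % N ∈ Finset.range N := Finset.mem_range.2 (Nat.mod_lt _ (by omega))
  have hdec : g^[n] = g^[n % N] ∘ (g^[N])^[n / N] := by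
    rw [← Function.iterate_mul, ← Function.iterate_add, Nat.mod_add_div]
  have hmem : ∀ w ∈ ball p r, (g^[N])^[n / N] w ∈ t (n % N) := fun w hw =>
    Set.mem_iInter₂.1 (hrU (hmap.iterate _ hw)).2 _ hmod
  have hK : K (n % N) ≤ ∑ i ∈ Finset.range N, K i :=
    Finset.single_le_sum (f := K) (fun _ _ => zero_le) hmod
  rw [hdec]
  calc dist (g^[n % N] ((g^[N])^[n / N] y)) (g^[n % N] ((g^[N])^[n / N] z))
      ≤ K (n % N) * dist ((g^[N])^[n / N] y) ((g^[N])^[n / N] z) :=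
        (htl _).dist_le_mul _ (hmem y hy) _ (hmem z hz)
    _ ≤ (∑ i ∈ Finset.range N, K i : NNReal) * ((c : ℝ) ^ (n / N) * dist y z) := by
        gcongr
        exact hpow _ y hy z hz
    _ ≤ ε * dist y z := by
        rw [← mul_assoc]
        gcongr

/-- Near a point attracted by a hyperbolically stable fixed point the Lipschitz constants of the
iterates tend to zero. -/
theorem exists_ball_iterate_contracting_of_tendsto {g : E → E} (hg : ContDiff ℝ 1 g) {p x : E}
    (hp : g p = p) {N : ℕ} (hN : 1 ≤ N) (hlt : ‖(fderiv ℝ g p) ^ N‖ < 1)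
    (hx : Tendsto (fun n : ℕ => g^[n] x) atTop (𝓝 p)) :
    ∃ r > 0, ∀ ε > 0, ∀ᶠ n in atTop, ∀ y ∈ ball x r, ∀ z ∈ ball x r,
      dist (g^[n] y) (g^[n] z) ≤ ε * dist y z := by
  obtain ⟨ρ, hρ, hcontr⟩ := exists_ball_iterate_contracting hg hp hN hlt
  obtain ⟨a, ha⟩ := (hx.eventually_mem (ball_mem_nhds p hρ)).exists
  obtain ⟨K, s, hs, hsl⟩ := hg.exists_lipschitzOnWith_iterate a x
  have hpre : g^[a] ⁻¹' ball p ρ ∈ 𝓝 x :=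
    (hg.continuous.iterate a).continuousAt.preimage_mem_nhds (isOpen_ball.mem_nhds ha)
  obtain ⟨r, hr, hsub⟩ := Metric.mem_nhds_iff.1 (inter_mem hs hpre)
  refine ⟨r, hr, fun ε hε => ?_⟩
  obtain ⟨b, hb⟩ := eventually_atTop.1 (hcontr (ε / (K + 1)) (by positivity))
  filter_upwards [eventually_ge_atTop (a + b)] with n hn y hy z hz
  obtain ⟨e, rfl⟩ := Nat.exists_eq_add_of_le hn
  rw [show a + b + e = (b + e) + a by ring, Function.iterate_add_apply _ (b + e),
    Function.iterate_add_apply _ (b + e)]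
  calc _ ≤ ε / (K + 1) * dist (g^[a] y) (g^[a] z) :=
        hb (b + e) (by omega) _ (hsub hy).2 _ (hsub hz).2
    _ ≤ ε / (K + 1) * (K * dist y z) := by
        gcongr; exact hsl.dist_le_mul y (hsub hy).1 z (hsub hz).1
    _ ≤ ε / (K + 1) * ((K + 1) * dist y z) := by gcongr; linarith
    _ = ε * dist y z := by field_simp

end LocalContraction

section PullComp

variable {d M : ℕ} {X : Set (EuclideanSpace ℝ (Fin d))}
  {f : Fin M → EuclideanSpace ℝ (Fin d) → EuclideanSpace ℝ (Fin d)} {v : ℤ → Fin M}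

theorem pullComp_add (k : ℤ) (a b : ℕ) :
    pullComp f v k (a + b) = pullComp f v k a ∘ pullComp f v (k - a) b := by
  induction b with
  | zero => rfl
  | succ b ih =>
    rw [← add_assoc, pullComp, pullComp, ih, Function.comp_assoc]
    congr 4
    push_cast
    ring

theorem pullComp_add_one (k : ℤ) (n : ℕ) :
    pullComp f v (k + 1) (n + 1) = f (v k) ∘ pullComp f v k n := by
  rw [add_comm n, pullComp_add]
  simp [pullComp]

theorem pullComp_eq_iterate {k : ℤ} {n : ℕ} {i : Fin M}
    (h : ∀ j, k - n ≤ j → j < k → v j = i) : pullComp f v k n = (f i)^[n] := by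
  induction n with
  | zero => rfl
  | succ n ih =>
    push_cast at h
    rw [pullComp, Function.iterate_succ, h _ le_rfl (by omega),
      ih fun j h1 h2 => h j (by omega) h2]

theorem mapsTo_pullComp (hf : ∀ i, Set.MapsTo (f i) X X) (k : ℤ) (n : ℕ) :
    Set.MapsTo (pullComp f v k n) X X := by
  induction n with
  | zero => exact Set.mapsTo_id X
  | succ n ih => exact ih.comp (hf _)

theorem continuous_pullComp (hf : ∀ i, Continuous (f i)) (k : ℤ) (n : ℕ) :
    Continuous (pullComp f v k n) := by
  induction n with
  | zero => exact continuous_id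
  | succ n ih => exact ih.comp (hf _)

theorem antitone_image_pullComp (hf : ∀ i, Set.MapsTo (f i) X X) (k : ℤ) :
    Antitone fun n => pullComp f v k n '' X := by
  refine antitone_nat_of_succ_le fun n => ?_
  rintro _ ⟨y, hy, rfl⟩
  exact ⟨_, hf _ hy, rfl⟩

theorem IsEntireSolution.eq_pullComp {x : ℤ → EuclideanSpace ℝ (Fin d)}
    (hx : IsEntireSolution X f v x) (k : ℤ) (n : ℕ) : x k = pullComp f v k n (x (k - n)) := by
  induction n with
  | zero => simp [pullComp]
  | succ n ih =>
    rw [ih, pullComp, Function.comp_apply]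
    push_cast
    rw [← hx.2, show k - (n + 1 : ℤ) + 1 = k - n by ring]

/-- Past inputs are forgotten at time `k`: the pullback images of `X` at time `k` become
arbitrarily small. -/
def PullbackContracting (X : Set (EuclideanSpace ℝ (Fin d)))
    (f : Fin M → EuclideanSpace ℝ (Fin d) → EuclideanSpace ℝ (Fin d)) (v : ℤ → Fin M) (k : ℤ) :
    Prop :=
  ∀ ε > 0, ∃ n, ∀ y ∈ X, ∀ z ∈ X, dist (pullComp f v k n y) (pullComp f v k n z) ≤ ε

theorem PullbackContracting.mono (hX : IsCompact X) (hc : ∀ i, Continuous (f i))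
    (hf : ∀ i, Set.MapsTo (f i) X X) {s k : ℤ} (hsk : s ≤ k) (h : PullbackContracting X f v s) :
    PullbackContracting X f v k := by
  intro ε hε
  obtain ⟨a, rfl⟩ := Int.le.dest hsk
  obtain ⟨δ, hδ, hu⟩ := Metric.uniformContinuousOn_iff.1
    (hX.uniformContinuousOn_of_continuous (continuous_pullComp (v := v) hc (s + a) a).continuousOn)
    ε hε
  obtain ⟨n, hn⟩ := h (δ / 2) (half_pos hδ)
  refine ⟨a + n, fun y hy z hz => ?_⟩
  rw [pullComp_add, add_sub_cancel_right]
  exact (hu _ (mapsTo_pullComp hf s n hy) _ (mapsTo_pullComp hf s n hz)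
    ((hn y hy z hz).trans_lt (half_lt_self hδ))).le

/-- A pullback contracting system has a one-point pullback image at each time, and these points
form its only entire solution. -/
theorem exists_entireSolution_of_pullbackContracting (hXne : X.Nonempty) (hX : IsCompact X)
    (hc : ∀ i, Continuous (f i)) (hf : ∀ i, Set.MapsTo (f i) X X)
    (h : ∀ k, PullbackContracting X f v k) :
    ∃ x : ℤ → EuclideanSpace ℝ (Fin d), IsEntireSolution X f v x ∧
      (∀ x', IsEntireSolution X f v x' → x' = x) ∧
      ∀ k, (⋂ n ≥ 1, pullComp f v k n '' X) = {x k} := by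
  have hex : ∀ k, (⋂ n, pullComp f v k n '' X).Nonempty := fun k =>
    IsCompact.nonempty_iInter_of_sequence_nonempty_isCompact_isClosed _
      (fun n => antitone_image_pullComp hf k n.le_succ) (fun n => hXne.image _)
      (hX.image (continuous_pullComp hc k 0))
      (fun n => (hX.image (continuous_pullComp hc k n)).isClosed)
  choose x hx using hex
  have huniq : ∀ k y, (∀ n ≥ 1, y ∈ pullComp f v k n '' X) → y = x k := by
    intro k y hy
    refine dist_le_zero.1 (le_of_forall_pos_le_add fun ε hε => ?_)
    obtain ⟨n, hn⟩ := h k ε hε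
    obtain ⟨a, ha, hya⟩ := antitone_image_pullComp hf k n.le_succ (hy (n + 1) (by omega))
    obtain ⟨b, hb, hxb⟩ := Set.mem_iInter.1 (hx k) n
    simpa [hya, hxb] using hn a ha b hb
  refine ⟨x, ⟨fun k => ?_, fun k => ?_⟩, fun x' hx' => ?_, fun k => ?_⟩
  · simpa [pullComp] using Set.mem_iInter.1 (hx k) 0
  · refine (huniq _ _ fun n hn => ?_).symm
    obtain ⟨n, rfl⟩ := Nat.exists_eq_add_of_le' hn
    obtain ⟨a, ha, hxa⟩ := Set.mem_iInter.1 (hx k) n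
    exact ⟨a, ha, by rw [pullComp_add_one, Function.comp_apply, hxa]⟩
  · exact funext fun k => huniq _ _ fun n _ => ⟨_, hx'.1 _, (hx'.eq_pullComp k n).symm⟩
  · ext y
    simp only [Set.mem_iInter, Set.mem_singleton_iff]
    refine ⟨huniq k y, ?_⟩
    rintro rfl n _
    exact Set.mem_iInter.1 (hx k) n

theorem PullbackContracting.tendsto_sSup_norm_sub {k : ℤ} (hXne : X.Nonempty)
    (hf : ∀ i, Set.MapsTo (f i) X X) (h : PullbackContracting X f v k)
    {p : EuclideanSpace ℝ (Fin d)} (hp : (⋂ n ≥ 1, pullComp f v k n '' X) = {p}) :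
    Tendsto (fun n : ℕ => sSup ((fun y => ‖y - p‖) '' (pullComp f v k n '' X))) atTop (𝓝 0) := by
  rw [Metric.tendsto_atTop]
  intro ε hε
  obtain ⟨m, hm⟩ := h (ε / 2) (half_pos hε)
  have hpm : p ∈ pullComp f v k m '' X := by
    have : p ∈ ⋂ n ≥ 1, pullComp f v k n '' X := hp ▸ Set.mem_singleton p
    exact antitone_image_pullComp hf k m.le_succ (Set.mem_iInter₂.1 this (m + 1) (by omega))
  obtain ⟨b, hb, hpb⟩ := hpm
  refine ⟨m, fun n hn => ?_⟩
  have hle : sSup ((fun y => ‖y - p‖) '' (pullComp f v k n '' X)) ≤ ε / 2 := by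
    refine csSup_le ((hXne.image _).image _) ?_
    rintro _ ⟨y, hy, rfl⟩
    obtain ⟨a, ha, rfl⟩ := antitone_image_pullComp hf k hn hy
    simpa [← hpb, dist_eq_norm] using hm a ha b hb
  have hnonneg : 0 ≤ sSup ((fun y => ‖y - p‖) '' (pullComp f v k n '' X)) := by
    refine Real.sSup_nonneg ?_
    rintro _ ⟨y, _, rfl⟩
    exact norm_nonneg _
  rw [Real.dist_0_eq_abs, abs_of_nonneg hnonneg]
  linarith

end PullComp

section Blocks

variable {d M : ℕ} {X : Set (EuclideanSpace ℝ (Fin d))}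
  {f : Fin M → EuclideanSpace ℝ (Fin d) → EuclideanSpace ℝ (Fin d)} {v : ℤ → Fin M}

theorem eq_of_no_switch {a b : ℤ} (h : ∀ s, a < s → s ≤ b → v (s - 1) = v s) :
    ∀ j, a ≤ j → j ≤ b → v j = v a := by
  intro j hj
  induction j, hj using Int.leInduction with
  | base => exact fun _ => rfl
  | succ j hj ih =>
    intro hjb
    rw [← ih (by omega), ← h (j + 1) (by omega) hjb, add_sub_cancel_right]

/-- The block preceding a switch time `s`, when there are earlier switch times. -/
theorem MinRepetitions.exists_block {m : ℕ} (hv : MinRepetitions v m)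
    (hinf : ∀ K : ℤ, ∃ s ≤ K, v (s - 1) ≠ v s) {s : ℤ} (hs : v (s - 1) ≠ v s) :
    ∃ n : ℕ, 1 ≤ n ∧ m ≤ n ∧ v (s - n - 1) ≠ v (s - n) ∧
      ∀ j, s - n ≤ j → j < s → v j = v (s - n) := by
  obtain ⟨a, ⟨has, ha⟩, hmax⟩ := Int.exists_greatest_of_bdd
    (P := fun a => a < s ∧ v (a - 1) ≠ v a) ⟨s, fun z hz => hz.1.le⟩
    (by obtain ⟨a, ha, h⟩ := hinf (s - 1); exact ⟨a, by omega, h⟩)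
  have hconst : ∀ j, a ≤ j → j ≤ s - 1 → v j = v a := eq_of_no_switch fun t hat hts => by
    by_contra hne
    exact absurd (hmax t ⟨by omega, hne⟩) (by omega)
  obtain ⟨n, rfl⟩ : ∃ n : ℕ, a = s - n := ⟨(s - a).toNat, by omega⟩
  refine ⟨n, by omega, ?_, ha, fun j h1 h2 => hconst j h1 (by omega)⟩
  by_contra! hnm
  have h1 := hv (s - n - 1) (by rwa [sub_add_cancel]) (n + 1) (by omega) (by omega)
  rw [sub_add_cancel] at h1
  push_cast at h1
  rw [show s - (n : ℤ) - 1 + (n + 1) = s by ring] at h1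
  exact hs (by rw [h1, hconst (s - 1) (by omega) le_rfl])

/-- If long blocks map members of a family `𝓑` of sets contractingly into members of `𝓑`, and long
blocks of a symbol `i` map `X` into a member of `𝓑`, then inputs with long blocks in which `i`
recurs in the past are pullback contracting. -/
theorem pullbackContracting_of_blocks {𝓑 : Set (Set (EuclideanSpace ℝ (Fin d)))} {m : ℕ} {D : ℝ}
    {i : Fin M} (hX : IsCompact X) (hc : ∀ i, Continuous (f i)) (hf : ∀ i, Set.MapsTo (f i) X X)
    (hD : ∀ B ∈ 𝓑, ∀ y ∈ B, ∀ z ∈ B, dist y z ≤ D)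
    (hstep : ∀ B ∈ 𝓑, ∀ k, ∀ n ≥ m, ∃ B' ∈ 𝓑, Set.MapsTo (f k)^[n] B B' ∧
      ∀ y ∈ B, ∀ z ∈ B, dist ((f k)^[n] y) ((f k)^[n] z) ≤ 1 / 2 * dist y z)
    (hstart : ∀ n ≥ m, ∃ B ∈ 𝓑, Set.MapsTo (f i)^[n] X B)
    (hcontr : ∀ ε > 0, ∃ n, ∀ y ∈ X, ∀ z ∈ X, dist ((f i)^[n] y) ((f i)^[n] z) ≤ ε)
    (hv : MinRepetitions v m) (hrec : ∀ K : ℤ, ∃ k : ℤ, k ≤ K ∧ v k = i) (k : ℤ) :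
    PullbackContracting X f v k := by
  by_cases hinf : ∀ K : ℤ, ∃ s ≤ K, v (s - 1) ≠ v s
  · have hcapture : ∀ l : ℕ, ∀ s, v (s - 1) ≠ v s → (∃ a < s, s - a ≤ l ∧ v a = i) →
        ∃ n, ∃ B ∈ 𝓑, Set.MapsTo (pullComp f v s n) X B := by
      intro l
      induction l with
      | zero => rintro s - ⟨a, h1, h2, -⟩; exact absurd h2 (by push_cast; omega)
      | succ l ih =>
        rintro s hs ⟨a, has, hal, hai⟩
        obtain ⟨n, hn1, hnm, hsw, hblock⟩ := hv.exists_block hinf hs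
        have hit := pullComp_eq_iterate (f := f) hblock
        push_cast at hal
        rcases le_or_gt (s - n) a with hle | hlt
        · obtain ⟨B, hB, hmap⟩ := hstart n hnm
          refine ⟨n, B, hB, ?_⟩
          rwa [hit, ← hblock a hle has, hai]
        · obtain ⟨n', B, hB, hmap⟩ := ih (s - n) hsw ⟨a, hlt, by omega, hai⟩
          obtain ⟨B', hB', hmap', -⟩ := hstep B hB (v (s - n)) n hnm
          refine ⟨n + n', B', hB', ?_⟩
          rw [pullComp_add, hit]
          exact hmap'.comp hmap
    have hshrink : ∀ q : ℕ, ∀ s, v (s - 1) ≠ v s → ∃ n, ∃ B ∈ 𝓑,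
        Set.MapsTo (pullComp f v s n) X B ∧ ∀ y ∈ X, ∀ z ∈ X,
          dist (pullComp f v s n y) (pullComp f v s n z) ≤ (1 / 2) ^ q * D := by
      intro q
      induction q with
      | zero =>
        intro s hs
        obtain ⟨a, ha, hai⟩ := hrec (s - 1)
        obtain ⟨n, B, hB, hmap⟩ := hcapture (s - a).toNat s hs ⟨a, by omega, by omega, hai⟩
        exact ⟨n, B, hB, hmap, fun y hy z hz => by simpa using hD B hB _ (hmap hy) _ (hmap hz)⟩
      | succ q ih =>
        intro s hs
        obtain ⟨n, -, hnm, hsw, hblock⟩ := hv.exists_block hinf hs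
        obtain ⟨n', B, hB, hmap, hdist⟩ := ih (s - n) hsw
        obtain ⟨B', hB', hmap', hdist'⟩ := hstep B hB (v (s - n)) n hnm
        refine ⟨n + n', B', hB', ?_⟩
        rw [pullComp_add, pullComp_eq_iterate hblock]
        refine ⟨hmap'.comp hmap, fun y hy z hz => (hdist' _ (hmap hy) _ (hmap hz)).trans ?_⟩
        rw [pow_succ']
        linarith [hdist y hy z hz]
    obtain ⟨s, hsk, hs⟩ := hinf k
    refine PullbackContracting.mono hX hc hf hsk fun ε hε => ?_
    have htend : Tendsto (fun q : ℕ => (1 / 2 : ℝ) ^ q * D) atTop (𝓝 0) := by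
      simpa using (tendsto_pow_atTop_nhds_zero_of_lt_one (r := (1 / 2 : ℝ)) (by norm_num)
        (by norm_num)).mul_const D
    obtain ⟨q, hq⟩ := (htend.eventually_lt_const hε).exists
    obtain ⟨n, -, -, -, hn⟩ := hshrink q s hs
    exact ⟨n, fun y hy z hz => (hn y hy z hz).trans hq.le⟩
  · push Not at hinf
    obtain ⟨K, hK⟩ := hinf
    have hconst : ∀ j < K, v j = i := by
      intro j hj
      obtain ⟨a, haj, hai⟩ := hrec j
      rw [← hai]
      exact eq_of_no_switch (b := K) (fun s _ hs => hK s hs) j haj hj.le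
    refine PullbackContracting.mono hX hc hf (min_le_right K k) fun ε hε => ?_
    obtain ⟨n, hn⟩ := hcontr ε hε
    refine ⟨n, ?_⟩
    rwa [pullComp_eq_iterate fun j _ hj => hconst j (lt_of_lt_of_le hj (min_le_left K k))]

end Blocks

/-- Theorem `thm:echoone`: under Assumption 1, suppose moreover there is a
symbol `i*` with `L i* = 1` whose map attracts the whole space uniformly to its unique
fixed point. Then there is `m_min ≥ 1` such that for every input `v` with minimum
repetitions `≥ m_min` in which `i*` occurs at arbitrarily negative times, `X_0(v)` is a
singleton `{x₀}`, there is a unique entire solution (passing through `x₀` at time `0`),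
and it is globally pullback attracting: the system has echo index one. -/
theorem echo_index_one_of_uniformly_attracting_symbol
    {d M : ℕ} (X : Set (EuclideanSpace ℝ (Fin d)))
    (hXne : X.Nonempty) (hXcomp : IsCompact X)
    (f : Fin M → EuclideanSpace ℝ (Fin d) → EuclideanSpace ℝ (Fin d))
    (hreg : ∀ i, ContDiff ℝ 1 (f i)) (hfmap : ∀ i, Set.MapsTo (f i) X X)
    (L : Fin M → ℕ) (xfix : Fin M → ℕ → EuclideanSpace ℝ (Fin d))
    (hfixX : ∀ i, ∀ j < L i, xfix i j ∈ X)
    (hfixed : ∀ i, ∀ j < L i, f i (xfix i j) = xfix i j)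
    (hdistinct : ∀ i, ∀ j < L i, ∀ j' < L i, xfix i j = xfix i j' → j = j')
    (hhyp : ∀ i, ∀ j < L i, ∃ N : ℕ, 1 ≤ N ∧ ‖(fderiv ℝ (f i) (xfix i j)) ^ N‖ < 1)
    (P : Fin M → ℕ → Fin M → ℕ)
    (hPid : ∀ i, ∀ j < L i, P i j i = j)
    (hPlt : ∀ i k, ∀ j < L i, P i j k < L k)
    (hPbasin : ∀ i k, ∀ j < L i, xfix i j ∈ basinOf X (f k) (xfix k (P i j k)))
    (istar : Fin M) (hLone : L istar = 1)
    (huniform : Filter.Tendsto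
      (fun m : ℕ => sSup ((fun y => ‖(f istar)^[m] y - xfix istar 0‖) '' X))
      Filter.atTop (nhds 0)) :
    ∃ m_min : ℕ, 1 ≤ m_min ∧
      ∀ v : ℤ → Fin M, MinRepetitions v m_min →
        (∀ K : ℤ, ∃ k : ℤ, k ≤ K ∧ v k = istar) →
        ∃ x₀ : EuclideanSpace ℝ (Fin d),
          (⋂ n ≥ 1, pullComp f v 0 n '' X) = {x₀} ∧
          (∃! x : ℤ → EuclideanSpace ℝ (Fin d), IsEntireSolution X f v x) ∧
          (∀ x : ℤ → EuclideanSpace ℝ (Fin d), IsEntireSolution X f v x → x 0 = x₀) ∧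
          Filter.Tendsto
            (fun n : ℕ => sSup ((fun y => ‖y - x₀‖) '' (pullComp f v 0 n '' X)))
            Filter.atTop (nhds 0) := by
  have hcont : ∀ i, Continuous (f i) := fun i => (hreg i).continuous
  have hunif : ∀ ε > 0, ∀ᶠ n in atTop, ∀ y ∈ X, dist ((f istar)^[n] y) (xfix istar 0) < ε := by
    intro ε hε
    filter_upwards [huniform.eventually_lt_const hε] with n hn y hy
    refine lt_of_le_of_lt ?_ hn
    rw [dist_eq_norm]
    refine le_csSup ?_ ⟨y, hy, rfl⟩
    exact (hXcomp.image ((((hcont istar).iterate n).sub continuous_const).norm)).bddAbove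
  have hlocal : ∀ a : (Σ i, Fin (L i)) × Fin M, ∀ᶠ δ in 𝓝[>] (0 : ℝ),
      ∀ ε > 0, ∀ᶠ n in atTop, ∀ y ∈ ball (xfix a.1.1 a.1.2) δ, ∀ z ∈ ball (xfix a.1.1 a.1.2) δ,
        dist ((f a.2)^[n] y) ((f a.2)^[n] z) ≤ ε * dist y z := by
    rintro ⟨⟨i, j⟩, k⟩
    have hlt := hPlt i k j j.2
    obtain ⟨N, hN, hnorm⟩ := hhyp k _ hlt
    obtain ⟨r, hr, h⟩ := exists_ball_iterate_contracting_of_tendsto (hreg k) (hfixed k _ hlt) hN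
      hnorm (hPbasin i k j j.2).2
    filter_upwards [Ioo_mem_nhdsGT hr] with δ hδ ε hε
    filter_upwards [h ε hε] with n hn y hy z hz
    exact hn y (ball_subset_ball hδ.2.le hy) z (ball_subset_ball hδ.2.le hz)
  obtain ⟨δ, hδ, hδpos⟩ := ((eventually_all.2 hlocal).and self_mem_nhdsWithin).exists
  replace hδpos : 0 < δ := hδpos
  have hlarge : ∀ a : (Σ i, Fin (L i)) × Fin M, ∀ᶠ n in atTop,
      (∀ y ∈ ball (xfix a.1.1 a.1.2) δ, ∀ z ∈ ball (xfix a.1.1 a.1.2) δ,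
        dist ((f a.2)^[n] y) ((f a.2)^[n] z) ≤ 1 / 2 * dist y z) ∧
      dist ((f a.2)^[n] (xfix a.1.1 a.1.2)) (xfix a.2 (P a.1.1 a.1.2 a.2)) < δ / 2 := fun a =>
    (hδ a (1 / 2) (by norm_num)).and
      ((hPbasin a.1.1 a.2 a.1.2 a.1.2.2).2.eventually_mem (ball_mem_nhds _ (half_pos hδpos)))
  obtain ⟨m, hm⟩ := eventually_atTop.1 ((eventually_all.2 hlarge).and (hunif δ hδpos))
  refine ⟨m + 1, by omega, fun v hv hrec => ?_⟩
  have hpc : ∀ k, PullbackContracting X f v k := by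
    refine pullbackContracting_of_blocks (D := 2 * δ)
      (𝓑 := {B | ∃ i, ∃ j < L i, B = ball (xfix i j) δ}) hXcomp hcont hfmap ?_ ?_ ?_ ?_ hv hrec
    · rintro _ ⟨i, j, -, rfl⟩ y hy z hz
      have := dist_triangle_right y z (xfix i j)
      rw [mem_ball] at hy hz
      linarith
    · rintro _ ⟨i, j, hj, rfl⟩ k n hn
      obtain ⟨hcontr, hnear⟩ := (hm n (by omega)).1 ⟨⟨i, j, hj⟩, k⟩
      refine ⟨_, ⟨k, _, hPlt i k j hj, rfl⟩, fun y hy => ?_, hcontr⟩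
      have h1 := hcontr y hy _ (mem_ball_self hδpos)
      have h2 := dist_triangle ((f k)^[n] y) ((f k)^[n] (xfix i j)) (xfix k (P i j k))
      rw [mem_ball] at hy ⊢
      dsimp only at h1 hnear
      linarith
    · exact fun n hn => ⟨_, ⟨istar, 0, by omega, rfl⟩, (hm n (by omega)).2⟩
    · intro ε hε
      obtain ⟨n, hn⟩ := (hunif (ε / 2) (half_pos hε)).exists
      refine ⟨n, fun y hy z hz => ?_⟩
      have := dist_triangle_right ((f istar)^[n] y) ((f istar)^[n] z) (xfix istar 0)
      linarith [hn y hy, hn z hz]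
  obtain ⟨x, hx, huniq, hsing⟩ :=
    exists_entireSolution_of_pullbackContracting hXne hXcomp hcont hfmap hpc
  exact ⟨x 0, hsing 0, ⟨x, hx, huniq⟩, fun x' hx' => by rw [huniq x' hx'],
    (hpc 0).tendsto_sSup_norm_sub hXne hfmap (hsing 0)⟩
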